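/- arXiv:2305.09314 — 2 statements merged into one kernel-verified Lean document; each statement's English description precedes it below -/
import Mathlib

section
/- Let φ be a priority-based allocation mechanism that is DA-representable through the mapping τ. Then the worst-case auditability index of φ equals 2 (i.e., #φ = 2) if and only if for every problem θ = (P, r) and every outcome ω ≠ φ(θ): either ω is not stable at (P, τ(θ)), or ω is stable at (P, τ(θ)) and there exist two individuals i and j such that (a) ω(j) P_i ω(i) and ω(i) P_j ω(j), and (b) for every object o ∉ {ω(i), ω(j)}, either o P_i ω(i) or o P_j ω(j). -/
/-! ## General auditability framework (Grigoryan–Möller, "A Theory of Auditability") -/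

section Audit

variable {ι : Type*} [Fintype ι] [DecidableEq ι]
variable {Θi : ι → Type*} {Ωi : ι → Type*}

/-- A nonempty group `G` detects the deviation `ω ≠ φ θ`: for every feasible problem
that agrees with `θ` on `G`, some member of `G` receives an outcome different from
her outcome under `ω`. -/
def Detects (ΘS : Set (∀ i, Θi i)) (φ : (∀ i, Θi i) → (∀ i, Ωi i))
    (θ : ∀ i, Θi i) (ω : ∀ i, Ωi i) (G : Finset ι) : Prop :=
  G.Nonempty ∧ ∀ θ' ∈ ΘS, (∀ i ∈ G, θ' i = θ i) → ∃ i ∈ G, ω i ≠ φ θ' i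

/-- The minimal size of a group detecting the deviation `ω`. -/
noncomputable def minDetect (ΘS : Set (∀ i, Θi i)) (φ : (∀ i, Θi i) → (∀ i, Ωi i))
    (θ : ∀ i, Θi i) (ω : ∀ i, Ωi i) : ℕ :=
  sInf {n | ∃ G : Finset ι, G.card = n ∧ Detects ΘS φ θ ω G}

/-- The auditability index `#φ^θ`: the maximum over feasible deviations `ω ≠ φ θ`
of the minimal size of a detecting group. -/
noncomputable def auditIndex (ΩS : Set (∀ i, Ωi i)) (ΘS : Set (∀ i, Θi i))
    (φ : (∀ i, Θi i) → (∀ i, Ωi i)) (θ : ∀ i, Θi i) : ℕ :=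
  sSup {n | ∃ ω ∈ ΩS, ω ≠ φ θ ∧ minDetect ΘS φ θ ω = n}

/-- The worst-case auditability index `#φ`. -/
noncomputable def worstIndex (ΩS : Set (∀ i, Ωi i)) (ΘS : Set (∀ i, Θi i))
    (φ : (∀ i, Θi i) → (∀ i, Ωi i)) : ℕ :=
  sSup {n | ∃ θ ∈ ΘS, auditIndex ΩS ΘS φ θ = n}

end Audit

/-! ## Object allocation without money -/

section ObjectAlloc

variable {N : ℕ} {Θi : Fin N → Type*}

/-- Feasible outcomes: bijections from the `N` individuals to the `N` objects. -/
def allocΩS (N : ℕ) : Set (Fin N → Fin N) := {ω | Function.Bijective ω}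

/-- Object `o` is possible for individual `i` at type report `θi`. -/
def Possible (ΘS : Set (∀ i, Θi i)) (φ : (∀ i, Θi i) → (Fin N → Fin N))
    (i : Fin N) (θi : Θi i) (o : Fin N) : Prop :=
  ∃ θ ∈ ΘS, θ i = θi ∧ φ θ i = o

/-- Individual `i` clinches object `o` from the set `avail` at type report `θi`:
`o` is the unique object in `avail` that is possible for `i` at `θi`. -/
def Clinches (ΘS : Set (∀ i, Θi i)) (φ : (∀ i, Θi i) → (Fin N → Fin N))
    (i : Fin N) (θi : Θi i) (o : Fin N) (avail : Set (Fin N)) : Prop :=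
  o ∈ avail ∧ Possible ΘS φ i θi o ∧
    ∀ o' ∈ avail, Possible ΘS φ i θi o' → o' = o

/-- `φ` has a sequential clinching implementation at `θ`: there is an order `σ` over the
individuals such that, at each step `t`, the individual `σ t` clinches her `φ θ`-assignment
from the objects still available (those not assigned in earlier steps). -/
def SeqClinching (ΘS : Set (∀ i, Θi i)) (φ : (∀ i, Θi i) → (Fin N → Fin N))
    (θ : ∀ i, Θi i) : Prop :=
  ∃ σ : Fin N → Fin N, Function.Bijective σ ∧
    ∀ t : Fin N, Clinches ΘS φ (σ t) (θ (σ t)) (φ θ (σ t))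
      {o | ∀ s : Fin N, s < t → φ θ (σ s) ≠ o}

end ObjectAlloc

/-! ## Priority-based allocation -/

section PriorityBased

variable {N : ℕ}

/-- A type report in the priority-based allocation model: a strict preference
relation over the `N` objects together with a vector of priority scores. -/
abbrev PrioReport (N : ℕ) := (Fin N → Fin N → Prop) × (Fin N → ℝ)

/-- Feasible problems: each preference is a strict total order and priority scores
are strict (no two individuals have the same score at an object). -/
def prioΘS (N : ℕ) : Set (Fin N → PrioReport N) :=
  {θ | (∀ i, IsStrictTotalOrder (Fin N) (θ i).1) ∧
       ∀ i j o, i ≠ j → (θ i).2 o ≠ (θ j).2 o}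

/-- An outcome `ω` is stable at `(P, r)`: no individual prefers an object assigned to
somebody with a lower priority score at it. -/
def StableAt (P : Fin N → Fin N → Fin N → Prop) (r : Fin N → Fin N → ℝ)
    (ω : Fin N → Fin N) : Prop :=
  ¬ ∃ i j o, P i o (ω i) ∧ ω j = o ∧ r i o > r j o

/-- `ω` is the outcome of the individual-proposing Deferred Acceptance algorithm at
`(P, r)`, formalized via the Gale–Shapley characterization: `ω` is the
individual-optimal stable outcome, i.e. the stable outcome that every individual
weakly prefers to every stable outcome. -/
def IsDAOutcome (P : Fin N → Fin N → Fin N → Prop) (r : Fin N → Fin N → ℝ)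
    (ω : Fin N → Fin N) : Prop :=
  Function.Bijective ω ∧ StableAt P r ω ∧
    ∀ ω' : Fin N → Fin N, Function.Bijective ω' → StableAt P r ω' →
      ∀ i, ω i = ω' i ∨ P i (ω i) (ω' i)

/-- The position of object `o` in the strict preference `Pi`
(`1` = most preferred). -/
noncomputable def position (Pi : Fin N → Fin N → Prop) (o : Fin N) : ℕ :=
  Set.ncard {o' | Pi o' o} + 1

/-- The three requirements on the priority-modifying map `τ` of a DA-representation:
independence of irrelevant alternatives, monotonicity, and equal treatment. -/
structure TauAdmissible (N : ℕ)
    (τ : (Fin N → PrioReport N) → (Fin N → Fin N → ℝ)) : Prop where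
  iia : ∀ θ ∈ prioΘS N, ∀ θ' ∈ prioΘS N, ∀ i j o,
    position (θ i).1 o = position (θ' i).1 o →
    position (θ j).1 o = position (θ' j).1 o →
    ((θ i).2 o > (θ j).2 o ↔ (θ' i).2 o > (θ' j).2 o) →
    (τ θ i o > τ θ j o ↔ τ θ' i o > τ θ' j o)
  mono : ∀ θ ∈ prioΘS N, ∀ θ' ∈ prioΘS N, ∀ i j o,
    position (θ' i).1 o ≤ position (θ i).1 o →
    position (θ j).1 o ≤ position (θ' j).1 o →
    ((θ i).2 o > (θ j).2 o → (θ' i).2 o > (θ' j).2 o) →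
    (τ θ i o > τ θ j o → τ θ' i o > τ θ' j o)
  equalTreatment : ∀ θ ∈ prioΘS N, ∀ i j o,
    position (θ i).1 o = position (θ j).1 o →
    (θ i).2 o > (θ j).2 o → τ θ i o > τ θ j o

/-- `φ` is DA-representable through `τ`: `τ` is admissible and, at every problem
`θ = (P, r)`, `φ θ = DA(P, τ θ)`. -/
def DARepresentable (φ : (Fin N → PrioReport N) → (Fin N → Fin N))
    (τ : (Fin N → PrioReport N) → (Fin N → Fin N → ℝ)) : Prop :=
  TauAdmissible N τ ∧
    ∀ θ ∈ prioΘS N, IsDAOutcome (fun i => (θ i).1) (τ θ) (φ θ)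

/-- The condition of Theorem 2 on deviations at a problem with preferences `P` and
(modified) priorities `rmod`: every feasible deviation `ω ≠ φθ` is either unstable at
`(P, rmod)`, or stable and there are two individuals who prefer each other's
`ω`-objects to their own and such that no other object is worse than their own
`ω`-objects for both of them. -/
def TwoDetectableCond (P : Fin N → Fin N → Fin N → Prop)
    (rmod : Fin N → Fin N → ℝ) (φθ : Fin N → Fin N) : Prop :=
  ∀ ω : Fin N → Fin N, Function.Bijective ω → ω ≠ φθ →
    ¬ StableAt P rmod ω ∨
      (StableAt P rmod ω ∧ ∃ i j, i ≠ j ∧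
        P i (ω j) (ω i) ∧ P j (ω i) (ω j) ∧
        ∀ o, o ≠ ω i → o ≠ ω j → (P i o (ω i) ∨ P j o (ω j)))

end PriorityBased

open Function

section Rotation

variable {N : ℕ}

/-- In an individual-optimal stable outcome some object is desired by nobody: otherwise, handing
every object to its highest-priority admirer along the cycles of this reassignment would produce
a better stable outcome. -/
theorem IsDAOutcome.exists_undesired [NeZero N] {P : Fin N → Fin N → Fin N → Prop}
    {r : Fin N → Fin N → ℝ} {μ : Fin N → Fin N}
    (hP : ∀ i, IsStrictTotalOrder (Fin N) (P i)) (hμ : IsDAOutcome P r μ) :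
    ∃ o, ∀ l, ¬ P l o (μ l) := by
  classical
  by_contra! hdes
  obtain ⟨hbij, hstab, hopt⟩ := hμ
  have hmax : ∀ o, ∃ m, P m o (μ m) ∧ ∀ m', P m' o (μ m') → r m' o ≤ r m o := by
    intro o
    obtain ⟨m, hm, hle⟩ := Set.exists_max_image {m | P m o (μ m)} (fun m => r m o)
      (Set.toFinite _) (hdes o)
    exact ⟨m, hm, hle⟩
  choose f hf hfmax using hmax
  let g : Fin N → Fin N := fun l => f (μ l)
  let S : Set (Fin N) := periodicPts g
  have hbijOn : Set.BijOn g S S := bijOn_periodicPts g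
  let h : Fin N → Fin N := invFunOn g S
  have h_mem : ∀ m ∈ S, h m ∈ S ∧ g (h m) = m := fun m hm =>
    ⟨invFunOn_mem (hbijOn.surjOn hm), invFunOn_eq (hbijOn.surjOn hm)⟩
  let ω : Fin N → Fin N := fun m => if m ∈ S then μ (h m) else μ m
  have ω_mem : ∀ m ∈ S, ω m = μ (h m) := fun m hm => if_pos hm
  have ω_notMem : ∀ m ∉ S, ω m = μ m := fun m hm => if_neg hm
  have ω_better : ∀ m ∈ S, P m (ω m) (μ m) := by
    intro m hm
    have h1 := hf (μ (h m))
    have h2 : f (μ (h m)) = m := (h_mem m hm).2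
    rw [h2] at h1
    rwa [ω_mem m hm]
  have ω_weak : ∀ m x, P m x (ω m) → P m x (μ m) := by
    intro m x hx
    by_cases hm : m ∈ S
    · exact (hP m).trans _ _ _ hx (ω_better m hm)
    · rwa [ω_notMem m hm] at hx
  have ω_inj : Injective ω := by
    intro a b hab
    by_cases ha : a ∈ S <;> by_cases hb : b ∈ S
    · rw [ω_mem a ha, ω_mem b hb] at hab
      rw [← (h_mem a ha).2, ← (h_mem b hb).2, hbij.1 hab]
    · rw [ω_mem a ha, ω_notMem b hb] at hab
      exact absurd (hbij.1 hab ▸ (h_mem a ha).1) hb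
    · rw [ω_notMem a ha, ω_mem b hb] at hab
      exact absurd (hbij.1 hab ▸ (h_mem b hb).1) ha
    · rw [ω_notMem a ha, ω_notMem b hb] at hab
      exact hbij.1 hab
  have ω_stable : StableAt P r ω := by
    rintro ⟨m, l, x, hx, rfl, hr⟩
    have hx' := ω_weak m _ hx
    by_cases hl : l ∈ S
    · have h1 := hfmax (ω l) m hx'
      have h2 : f (ω l) = l := by
        rw [ω_mem l hl]
        exact (h_mem l hl).2
      rw [h2] at h1
      exact absurd hr (not_lt.2 h1)
    · rw [ω_notMem l hl] at hx' hr
      exact hstab ⟨m, l, _, hx', rfl, hr⟩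
  have hne : S.Nonempty := by
    obtain ⟨a, b, hab, heq⟩ := Finite.exists_ne_map_eq_of_infinite (fun n : ℕ => g^[n] 0)
    wlog hlt : a < b generalizing a b
    · exact this b a hab.symm heq.symm (by omega)
    refine ⟨g^[a] 0, mk_mem_periodicPts (n := b - a) (by omega) ?_⟩
    rw [IsPeriodicPt, IsFixedPt, ← iterate_add_apply, Nat.sub_add_cancel hlt.le]
    exact heq.symm
  obtain ⟨m, hm⟩ := hne
  have hb := ω_better m hm
  rcases hopt ω (Finite.injective_iff_bijective.1 ω_inj) ω_stable m with he | hlt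
  · rw [← he] at hb
    exact (hP m).irrefl _ hb
  · exact (hP m).irrefl _ ((hP m).trans _ _ _ hb hlt)

end Rotation

section Position

variable {N : ℕ}

theorem position_eq_one {Q : Fin N → Fin N → Prop} {x : Fin N} (h : ∀ y, ¬ Q y x) :
    position Q x = 1 := by
  simp [position, h]

theorem one_le_position (Q : Fin N → Fin N → Prop) (x : Fin N) : 1 ≤ position Q x := by
  simp [position]

/-- The preference ranking `x` first and all other objects in their natural order. -/
def topOrder (x a b : Fin N) : Prop := b ≠ x ∧ (a = x ∨ a < b)

theorem isStrictTotalOrder_topOrder (x : Fin N) :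
    IsStrictTotalOrder (Fin N) (topOrder x) where
  irrefl a h := by unfold topOrder at h; grind
  trans a b c hab hbc := by unfold topOrder at *; grind
  trichotomous a b := by unfold topOrder; grind

theorem isStrictTotalOrder_comap {Q : Fin N → Fin N → Prop} (hQ : IsStrictTotalOrder (Fin N) Q)
    {e : Fin N → Fin N} (he : Injective e) :
    IsStrictTotalOrder (Fin N) (fun a b => Q (e a) (e b)) where
  irrefl a := hQ.irrefl (e a)
  trans a b c := hQ.trans (e a) (e b) (e c)
  trichotomous _ _ h1 h2 := he (hQ.trichotomous _ _ h1 h2)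

end Position

section Tau

variable {N : ℕ} {φ : (Fin N → PrioReport N) → (Fin N → Fin N)}
  {τ : (Fin N → PrioReport N) → (Fin N → Fin N → ℝ)}

/-- The modified priority comparison of two individuals depends only on their own reports. -/
theorem TauAdmissible.lt_congr (hτ : TauAdmissible N τ) {θ θ' : Fin N → PrioReport N}
    (hθ : θ ∈ prioΘS N) (hθ' : θ' ∈ prioΘS N) {i j : Fin N} (hi : θ' i = θ i) (hj : θ' j = θ j)
    (x : Fin N) : τ θ i x > τ θ j x ↔ τ θ' i x > τ θ' j x :=
  hτ.iia θ hθ θ' hθ' i j x (by rw [hi]) (by rw [hj]) (by rw [hi, hj])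

/-- An individual with the highest score at her favourite object has the highest modified
priority there. -/
theorem TauAdmissible.top_lt (hτ : TauAdmissible N τ) {θ : Fin N → PrioReport N}
    (hθ : θ ∈ prioΘS N) {l m x : Fin N} (hx : position (θ l).1 x = 1)
    (hr : (θ l).2 x > (θ m).2 x) : τ θ l x > τ θ m x := by
  let η : Fin N → PrioReport N := fun a => ((θ l).1, (θ a).2)
  have hη : η ∈ prioΘS N := ⟨fun _ => hθ.1 l, hθ.2⟩
  refine hτ.mono η hη θ hθ l m x le_rfl ?_ (fun h => h) (hτ.equalTreatment η hη l m x rfl hr)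
  exact hx.le.trans (one_le_position _ _)

/-- Two individuals ranking an object equally, with scores on the same side of a third one, are
compared with the third one in the same way. -/
theorem TauAdmissible.lt_of_adjacent (hτ : TauAdmissible N τ) {θ : Fin N → PrioReport N}
    (hθ : θ ∈ prioΘS N) {i j k x : Fin N} (hij : i ≠ j) (hik : i ≠ k)
    (hpos : position (θ j).1 x = position (θ k).1 x) (hr : (θ k).2 x > (θ j).2 x)
    (hside : (θ k).2 x > (θ i).2 x ↔ (θ j).2 x > (θ i).2 x)
    (hki : τ θ k x > τ θ i x) : τ θ j x > τ θ i x := by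
  let η : Fin N → PrioReport N := fun a =>
    ((θ a).1, fun y => if y = x then (θ (Equiv.swap j k a)).2 y else (θ a).2 y)
  have hη : η ∈ prioΘS N := by
    refine ⟨hθ.1, fun a b y hab => ?_⟩
    by_cases hy : y = x
    · simpa [η, hy] using hθ.2 _ _ x ((Equiv.swap j k).injective.ne hab)
    · simpa [η, hy] using hθ.2 _ _ y hab
  have ηj : (η j).2 x = (θ k).2 x := by simp [η]
  have ηk : (η k).2 x = (θ j).2 x := by simp [η]
  have ηi : (η i).2 x = (θ i).2 x := by simp [η, Equiv.swap_apply_of_ne_of_ne hij hik]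
  have h1 : τ η j x > τ η k x := hτ.equalTreatment η hη j k x hpos (by rw [ηj, ηk]; exact hr)
  have h2 : τ η k x > τ η i x :=
    (hτ.iia θ hθ η hη k i x rfl rfl (by rw [ηk, ηi]; exact hside)).1 hki
  exact (hτ.iia η hη θ hθ j i x rfl rfl (by rw [ηj, ηi]; exact hside)).1 (h2.trans h1)

theorem DARepresentable.apply_top (hφ : DARepresentable φ τ) {θ : Fin N → PrioReport N}
    (hθ : θ ∈ prioΘS N) {l x : Fin N} (hx : ∀ y, ¬ (θ l).1 y x)
    (hr : ∀ m, m ≠ l → (θ l).2 x > (θ m).2 x) : φ θ l = x := by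
  obtain ⟨hbij, hstab, -⟩ := hφ.2 θ hθ
  by_contra hne
  obtain ⟨m, hm⟩ := hbij.2 x
  have hml : m ≠ l := by rintro rfl; exact hne hm
  have hpref : (θ l).1 x (φ θ l) := by
    by_contra hcon
    exact hne ((hθ.1 l).trichotomous _ _ (hx _) hcon)
  exact hstab ⟨l, m, x, hpref, hm, hφ.1.top_lt hθ (position_eq_one hx) (hr m hml)⟩

/-- Reports of a group can be completed by individuals who rank their `ω`-object first and have
the highest score at it. -/
theorem DARepresentable.exists_completion (hφ : DARepresentable φ τ) (G : Finset (Fin N))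
    {ω : Fin N → Fin N} (hω : Injective ω) (θ : Fin N → PrioReport N)
    (hP : ∀ i ∈ G, IsStrictTotalOrder (Fin N) (θ i).1)
    (hr : ∀ i ∈ G, ∀ j ∈ G, i ≠ j → ∀ x, (θ i).2 x ≠ (θ j).2 x) :
    ∃ θ' ∈ prioΘS N, (∀ i ∈ G, θ' i = θ i) ∧ (∀ l ∉ G, φ θ' l = ω l) ∧
      ((∀ m ∈ G, ∀ l ∈ G, (θ m).1 (ω l) (ω m) → ¬ τ θ' m (ω l) > τ θ' l (ω l)) →
        StableAt (fun i => (θ' i).1) (τ θ') ω) := by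
  classical
  let C : Fin N → ℝ := fun x => ∑ i, |(θ i).2 x|
  have hC : ∀ i x, -C x ≤ (θ i).2 x ∧ (θ i).2 x ≤ C x := fun i x =>
    abs_le.1 (Finset.single_le_sum (f := fun i => |(θ i).2 x|)
      (fun _ _ => abs_nonneg _) (Finset.mem_univ i))
  have hC0 : ∀ x, 0 ≤ C x := fun x => Finset.sum_nonneg fun _ _ => abs_nonneg _
  let θ' : Fin N → PrioReport N := fun l =>
    if l ∈ G then θ l
    else (topOrder (ω l), fun x => if x = ω l then C x + 1 else -C x - 1 - (l : ℕ))
  have hin : ∀ l ∈ G, θ' l = θ l := fun l hl => if_pos hl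
  have hout : ∀ l ∉ G, θ' l =
      (topOrder (ω l), fun x => if x = ω l then C x + 1 else -C x - 1 - (l : ℕ)) :=
    fun l hl => if_neg hl
  have hhigh : ∀ l ∉ G, (θ' l).2 (ω l) = C (ω l) + 1 := fun l hl => by simp [hout l hl]
  have hlow : ∀ l ∉ G, ∀ x, x ≠ ω l → (θ' l).2 x = -C x - 1 - (l : ℕ) :=
    fun l hl x hx => by simp [hout l hl, hx]
  have hnat : ∀ l : Fin N, (0 : ℝ) ≤ (l : ℕ) := fun l => Nat.cast_nonneg _
  have htop : ∀ l ∉ G, ∀ m, m ≠ l → (θ' l).2 (ω l) > (θ' m).2 (ω l) := by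
    intro l hl m hml
    rw [hhigh l hl]
    by_cases hm : m ∈ G
    · rw [hin m hm]
      linarith [(hC m (ω l)).2]
    · rw [hlow m hm _ (hω.ne hml.symm)]
      linarith [hC0 (ω l), hnat m]
  have hmix : ∀ l ∉ G, ∀ m ∈ G, ∀ x, (θ' l).2 x ≠ (θ' m).2 x := by
    intro l hl m hm x
    rw [hin m hm]
    by_cases hx : x = ω l
    · rw [hx, hhigh l hl]
      have : (θ m).2 (ω l) < C (ω l) + 1 := by linarith [(hC m (ω l)).2]
      exact this.ne'
    · rw [hlow l hl x hx]
      have : -C x - 1 - (l : ℕ) < (θ m).2 x := by linarith [(hC m x).1, hnat l]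
      exact this.ne
  have hθ' : θ' ∈ prioΘS N := by
    refine ⟨fun l => ?_, fun a b x hab => ?_⟩
    · by_cases hl : l ∈ G
      · rw [hin l hl]
        exact hP l hl
      · rw [hout l hl]
        exact isStrictTotalOrder_topOrder _
    · by_cases ha : a ∈ G <;> by_cases hb : b ∈ G
      · rw [hin a ha, hin b hb]
        exact hr a ha b hb hab x
      · exact (hmix b hb a ha x).symm
      · exact hmix a ha b hb x
      · by_cases hxa : x = ω a
        · subst hxa
          exact (htop a ha b hab.symm).ne'
        · by_cases hxb : x = ω b
          · subst hxb
            exact (htop b hb a hab).ne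
          · rw [hlow a ha x hxa, hlow b hb x hxb]
            intro h
            have : ((a : ℕ) : ℝ) = (b : ℕ) := by linarith
            exact hab (Fin.ext (by exact_mod_cast this))
  have hfav : ∀ l ∉ G, ∀ y, ¬ (θ' l).1 y (ω l) := by
    intro l hl y
    rw [hout l hl]
    exact fun h => h.1 rfl
  refine ⟨θ', hθ', hin, fun l hl => hφ.apply_top hθ' (hfav l hl) (htop l hl), fun hG => ?_⟩
  rintro ⟨m, l, x, hx, rfl, hlt⟩
  have hml : m ≠ l := by rintro rfl; exact (hθ'.1 m).irrefl _ hx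
  by_cases hl : l ∈ G
  · by_cases hm : m ∈ G
    · refine hG m hm l hl ?_ hlt
      rw [← hin m hm]
      exact hx
    · exact hfav m hm _ hx
  · exact lt_asymm hlt (hφ.1.top_lt hθ' (position_eq_one (hfav l hl)) (htop l hl m hml))

end Tau

section Detection

variable {N : ℕ} {φ : (Fin N → PrioReport N) → (Fin N → Fin N)}
  {τ : (Fin N → PrioReport N) → (Fin N → Fin N → ℝ)}

theorem exists_mem_eq_of_eqOn_compl {G : Finset (Fin N)} {f g : Fin N → Fin N}
    (hf : Injective f) (hg : Surjective g) (h : ∀ l ∉ G, f l = g l) {i : Fin N} (hi : i ∈ G) :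
    ∃ l ∈ G, f i = g l := by
  obtain ⟨l, hl⟩ := hg (f i)
  refine ⟨l, ?_, hl.symm⟩
  by_contra hlG
  exact hlG (hf ((h l hlG).trans hl) ▸ hi)

theorem DARepresentable.not_detects_singleton (hφ : DARepresentable φ τ)
    {θ : Fin N → PrioReport N} (hθ : θ ∈ prioΘS N) {ω : Fin N → Fin N} (hω : Bijective ω)
    (i : Fin N) : ¬ Detects (prioΘS N) φ θ ω {i} := by
  rintro ⟨-, hdet⟩
  obtain ⟨θ', hθ', hag, hrest, -⟩ := hφ.exists_completion {i} hω.1 θ (fun j _ => hθ.1 j)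
    (fun a _ b _ hab x => hθ.2 a b x hab)
  obtain ⟨j, hj, hne⟩ := hdet θ' hθ' hag
  obtain ⟨l, hl, he⟩ := exists_mem_eq_of_eqOn_compl (hφ.2 θ' hθ').1.1 hω.2 hrest hj
  rw [Finset.mem_singleton] at hj hl
  subst hj hl
  exact hne he.symm

/-- A pair detecting a stable deviation consists of individuals who prefer each other's
objects. -/
theorem DARepresentable.mutual_of_detects (hφ : DARepresentable φ τ)
    {θ : Fin N → PrioReport N} (hθ : θ ∈ prioΘS N) {ω : Fin N → Fin N} (hω : Bijective ω)
    (hst : StableAt (fun i => (θ i).1) (τ θ) ω) {i j : Fin N} (hij : i ≠ j)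
    (hdet : Detects (prioΘS N) φ θ ω {i, j}) :
    (θ i).1 (ω j) (ω i) ∧ (θ j).1 (ω i) (ω j) := by
  obtain ⟨θ', hθ', hag, hrest, hstab⟩ := hφ.exists_completion {i, j} hω.1 θ (fun j _ => hθ.1 j)
    (fun a _ b _ hab x => hθ.2 a b x hab)
  have hstab' := hstab fun m hm l hl hp hlt =>
    hst ⟨m, l, _, hp, rfl, (hφ.1.lt_congr hθ hθ' (hag m hm) (hag l hl) _).2 hlt⟩
  obtain ⟨hbij, -, hopt⟩ := hφ.2 θ' hθ'
  have hdom := hopt ω hω hstab'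
  obtain ⟨a, ha, hia⟩ := exists_mem_eq_of_eqOn_compl hbij.1 hω.2 hrest
    (show i ∈ ({i, j} : Finset (Fin N)) by simp)
  obtain ⟨b, hb, hjb⟩ := exists_mem_eq_of_eqOn_compl hbij.1 hω.2 hrest
    (show j ∈ ({i, j} : Finset (Fin N)) by simp)
  obtain ⟨l, hl, hne⟩ := hdet.2 θ' hθ' hag
  have hab : a ≠ b := by
    rintro rfl
    exact hij (hbij.1 (hia.trans hjb.symm))
  have hd1 := hdom i
  have hd2 := hdom j
  simp only [hag i (by simp), hag j (by simp), hia, hjb] at hd1 hd2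
  simp only [Finset.mem_insert, Finset.mem_singleton] at ha hb hl
  have hωij : ω i ≠ ω j := hω.1.ne hij
  rcases ha with rfl | rfl <;> rcases hb with rfl | rfl <;> grind

theorem exists_just_above {a b : ℝ} (hab : a ≠ b) :
    ∃ c, c > a ∧ c ≠ b ∧ (c > b ↔ a > b) := by
  rcases lt_or_gt_of_ne hab with h | h
  · exact ⟨(a + b) / 2, by linarith, (by linarith : (a + b) / 2 < b).ne,
      ⟨fun h' => by linarith, fun h' => by linarith⟩⟩
  · exact ⟨a + 1, by linarith, (by linarith : b < a + 1).ne',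
      ⟨fun _ => h, fun _ => by linarith⟩⟩

/-- If a pair detects a stable deviation, no further object is worse than the own object for both
of its members. -/
theorem DARepresentable.cover_of_detects (hφ : DARepresentable φ τ)
    {θ : Fin N → PrioReport N} (hθ : θ ∈ prioΘS N) {ω : Fin N → Fin N} (hω : Bijective ω)
    (hst : StableAt (fun i => (θ i).1) (τ θ) ω) {i j : Fin N} (hij : i ≠ j)
    (hdet : Detects (prioΘS N) φ θ ω {i, j}) (o : Fin N) (hoi : o ≠ ω i) (hoj : o ≠ ω j) :
    (θ i).1 o (ω i) ∨ (θ j).1 o (ω j) := by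
  classical
  by_contra! hcon
  obtain ⟨hni, hnj⟩ := hcon
  obtain ⟨hpi, hpj⟩ := hφ.mutual_of_detects hθ hω hst hij hdet
  obtain ⟨k, rfl⟩ := hω.2 o
  have hki : k ≠ i := fun h => hoi (by rw [h])
  have hkj : k ≠ j := fun h => hoj (by rw [h])
  have hωij : ω i ≠ ω j := hω.1.ne hij
  have hPi := hθ.1 i
  have hPj := hθ.1 j
  have hjo : (θ j).1 (ω j) (ω k) := by
    by_contra h
    exact hoj (hPj.trichotomous _ _ hnj h)
  let e := Equiv.swap (ω j) (ω k)
  have e_i : e (ω i) = ω i := Equiv.swap_apply_of_ne_of_ne hωij hoi.symm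
  have e_j : e (ω j) = ω k := Equiv.swap_apply_left _ _
  have e_k : e (ω k) = ω j := Equiv.swap_apply_right _ _
  let Q : Fin N → Fin N → Prop := fun a b => (θ j).1 (e a) (e b)
  have hQ : IsStrictTotalOrder (Fin N) Q := isStrictTotalOrder_comap hPj e.injective
  have hQ1 : Q (ω i) (ω k) := by
    change (θ j).1 _ _
    rwa [e_i, e_k]
  have hQ2 : Q (ω k) (ω j) := by
    change (θ j).1 _ _
    rwa [e_k, e_j]
  have hQpos : position Q (ω i) = position (θ j).1 (ω i) := by
    unfold position
    congr 2
    ext y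
    change (θ j).1 (e y) (e (ω i)) ↔ (θ j).1 y (ω i)
    rw [e_i]
    by_cases hyj : y = ω j
    · subst hyj
      rw [e_j]
      exact ⟨fun h => (hPj.irrefl _ (hPj.trans _ _ _ (hPj.trans _ _ _ hpj hjo) h)).elim,
        fun h => (hPj.irrefl _ (hPj.trans _ _ _ hpj h)).elim⟩
    · by_cases hyk : y = ω k
      · subst hyk
        rw [e_k]
        exact ⟨fun h => (hPj.irrefl _ (hPj.trans _ _ _ hpj h)).elim,
          fun h => (hPj.irrefl _ (hPj.trans _ _ _ (hPj.trans _ _ _ hpj hjo) h)).elim⟩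
      · rw [show e y = y from Equiv.swap_apply_of_ne_of_ne hyj hyk]
  obtain ⟨c, hcj, hci, hside⟩ := exists_just_above (hθ.2 j i (ω i) hij.symm)
  let s : Fin N → ℝ := fun x => if x = ω i then c else max ((θ i).2 x) ((θ j).2 x) + 1
  have s_i : s (ω i) = c := if_pos rfl
  have hsi : ∀ x, s x ≠ (θ i).2 x := by
    intro x
    by_cases hx : x = ω i
    · subst hx
      rwa [s_i]
    · simp only [s, hx, if_false]
      exact (lt_of_le_of_lt (le_max_left _ _) (lt_add_one _)).ne'
  have hsj : ∀ x, s x ≠ (θ j).2 x := by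
    intro x
    by_cases hx : x = ω i
    · subst hx
      rw [s_i]
      exact hcj.ne'
    · simp only [s, hx, if_false]
      exact (lt_of_le_of_lt (le_max_right _ _) (lt_add_one _)).ne'
  let η : Fin N → PrioReport N := fun l => if l = k then (Q, s) else θ l
  have η_k : η k = (Q, s) := if_pos rfl
  have η_ne : ∀ l, l ≠ k → η l = θ l := fun l hl => if_neg hl
  obtain ⟨θ', hθ', hag, hrest, hstab⟩ := hφ.exists_completion {i, j, k} hω.1 η
    (by
      intro l _
      by_cases hl : l = k
      · rw [hl, η_k]
        exact hQ
      · rw [η_ne l hl]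
        exact hθ.1 l)
    (by
      intro a ha b hb hab x
      simp only [Finset.mem_insert, Finset.mem_singleton] at ha hb
      by_cases hak : a = k
      · have hbk : b ≠ k := fun h => hab (hak.trans h.symm)
        rw [hak, η_k, η_ne b hbk]
        rcases hb with rfl | rfl | rfl
        exacts [hsi x, hsj x, absurd rfl hbk]
      · by_cases hbk : b = k
        · rw [hbk, η_k, η_ne a hak]
          rcases ha with rfl | rfl | rfl
          exacts [(hsi x).symm, (hsj x).symm, absurd rfl hak]
        · rw [η_ne a hak, η_ne b hbk]
          exact hθ.2 a b x hab)
  have h_i : θ' i = θ i := (hag i (by simp)).trans (η_ne i hki.symm)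
  have h_j : θ' j = θ j := (hag j (by simp)).trans (η_ne j hkj.symm)
  have h_k : θ' k = (Q, s) := (hag k (by simp)).trans η_k
  have hkj_lt : τ θ' k (ω i) > τ θ' j (ω i) := by
    apply hφ.1.equalTreatment θ' hθ' k j
    · rw [h_k, h_j]
      exact hQpos
    · rw [h_k, h_j]
      change s (ω i) > _
      rwa [s_i]
  have hij_not : ¬ τ θ' i (ω j) > τ θ' j (ω j) := fun h =>
    hst ⟨i, j, _, hpi, rfl, (hφ.1.lt_congr hθ hθ' h_i h_j _).2 h⟩
  have hji_not : ¬ τ θ' j (ω i) > τ θ' i (ω i) := fun h =>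
    hst ⟨j, i, _, hpj, rfl, (hφ.1.lt_congr hθ hθ' h_j h_i _).2 h⟩
  have hki_not : ¬ τ θ' k (ω i) > τ θ' i (ω i) := by
    refine fun h => hji_not (hφ.1.lt_of_adjacent hθ' hij hki.symm ?_ ?_ ?_ h)
    · rw [h_k, h_j]
      exact hQpos.symm
    · rw [h_k, h_j]
      change s (ω i) > _
      rwa [s_i]
    · rw [h_k, h_j, h_i]
      change s (ω i) > _ ↔ _
      rwa [s_i]
  have hstab' := hstab (by
    intro m hm l hl hp hlt
    simp only [Finset.mem_insert, Finset.mem_singleton] at hm hl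
    rcases hm with rfl | rfl | rfl
    · rw [η_ne _ hki.symm] at hp
      rcases hl with rfl | rfl | rfl
      exacts [hPi.irrefl _ hp, hij_not hlt, hni hp]
    · rw [η_ne _ hkj.symm] at hp
      rcases hl with rfl | rfl | rfl
      exacts [hji_not hlt, hPj.irrefl _ hp, hnj hp]
    · rw [η_k] at hp
      rcases hl with rfl | rfl | rfl
      exacts [hki_not hlt, hQ.irrefl _ (hQ.trans _ _ _ hp hQ2), hQ.irrefl _ hp])
  obtain ⟨hbij, hDAst, hopt⟩ := hφ.2 θ' hθ'
  have hdom := hopt ω hω hstab'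
  have hdi := hdom i
  have hdj := hdom j
  simp only [h_i] at hdi
  simp only [h_j] at hdj
  have hmem : ∀ l ∈ ({i, j, k} : Finset (Fin N)),
      φ θ' l = ω i ∨ φ θ' l = ω j ∨ φ θ' l = ω k := by
    intro l hl
    obtain ⟨a, ha, hla⟩ := exists_mem_eq_of_eqOn_compl hbij.1 hω.2 hrest hl
    simp only [Finset.mem_insert, Finset.mem_singleton] at ha
    rcases ha with rfl | rfl | rfl <;> simp [hla]
  have hcase_i : φ θ' i = ω i ∨ φ θ' i = ω j := by
    rcases hmem i (by simp) with h | h | h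
    · exact Or.inl h
    · exact Or.inr h
    · rw [h] at hdi
      exact (hdi.elim hoi hni).elim
  have hcase_j : φ θ' j = ω i ∨ φ θ' j = ω j := by
    rcases hmem j (by simp) with h | h | h
    · exact Or.inl h
    · exact Or.inr h
    · rw [h] at hdj
      exact (hdj.elim hoj hnj).elim
  have hfix_i : φ θ' i = ω i := by
    refine hcase_i.resolve_right fun hi => ?_
    have hj : φ θ' j = ω i := hcase_j.resolve_right fun h => hij (hbij.1 (hi.trans h.symm))
    have hk : φ θ' k = ω k := by
      rcases hmem k (by simp) with h | h | h
      · exact (hkj (hbij.1 (h.trans hj.symm))).elim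
      · exact (hki (hbij.1 (h.trans hi.symm))).elim
      · exact h
    refine hDAst ⟨k, j, ω i, ?_, hj, hkj_lt⟩
    simp only [h_k, hk]
    exact hQ1
  have hfix_j : φ θ' j = ω j :=
    hcase_j.resolve_left fun h => hij (hbij.1 (hfix_i.trans h.symm))
  obtain ⟨l, hl, hne⟩ := hdet.2 θ' hθ' (by
    intro l hl
    simp only [Finset.mem_insert, Finset.mem_singleton] at hl
    rcases hl with rfl | rfl
    exacts [h_i, h_j])
  simp only [Finset.mem_insert, Finset.mem_singleton] at hl
  rcases hl with rfl | rfl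
  exacts [hne hfix_i.symm, hne hfix_j.symm]

/-- A blocking pair detects an unstable deviation. -/
theorem DARepresentable.exists_detects_of_not_stable (hφ : DARepresentable φ τ)
    {θ : Fin N → PrioReport N} (hθ : θ ∈ prioΘS N) {ω : Fin N → Fin N}
    (hst : ¬ StableAt (fun i => (θ i).1) (τ θ) ω) :
    ∃ i j, i ≠ j ∧ Detects (prioΘS N) φ θ ω {i, j} := by
  rw [StableAt, not_not] at hst
  obtain ⟨i, j, x, hp, rfl, hlt⟩ := hst
  refine ⟨i, j, ?_, by simp, fun θ' hθ' hag => ?_⟩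
  · rintro rfl
    exact lt_irrefl _ hlt
  · by_contra! hcon
    have h_i := hag i (by simp)
    refine (hφ.2 θ' hθ').2.1 ⟨i, j, ω j, ?_, (hcon j (by simp)).symm,
      (hφ.1.lt_congr hθ hθ' h_i (hag j (by simp)) _).1 hlt⟩
    simp only [h_i, ← hcon i (by simp)]
    exact hp

/-- Two individuals who prefer each other's objects and jointly prefer every other object
to their own detect the deviation. -/
theorem DARepresentable.detects_of_cover [NeZero N] (hφ : DARepresentable φ τ)
    {θ : Fin N → PrioReport N} {ω : Fin N → Fin N} {i j : Fin N}
    (hpi : (θ i).1 (ω j) (ω i)) (hpj : (θ j).1 (ω i) (ω j))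
    (hcov : ∀ o, o ≠ ω i → o ≠ ω j → ((θ i).1 o (ω i) ∨ (θ j).1 o (ω j))) :
    Detects (prioΘS N) φ θ ω {i, j} := by
  refine ⟨by simp, fun θ' hθ' hag => ?_⟩
  by_contra! hcon
  have h_i := hag i (by simp)
  have h_j := hag j (by simp)
  have ho_i := hcon i (by simp)
  have ho_j := hcon j (by simp)
  obtain ⟨o, ho⟩ := (hφ.2 θ' hθ').exists_undesired hθ'.1
  have hi := ho i
  have hj := ho j
  simp only [h_i, ← ho_i] at hi
  simp only [h_j, ← ho_j] at hj
  by_cases h1 : o = ω i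
  · exact hj (h1 ▸ hpj)
  · by_cases h2 : o = ω j
    · exact hi (h2 ▸ hpi)
    · exact (hcov o h1 h2).elim hi hj

end Detection

section Index

variable {N : ℕ} {φ : (Fin N → PrioReport N) → (Fin N → Fin N)}
  {τ : (Fin N → PrioReport N) → (Fin N → Fin N → ℝ)}

theorem Detects.mono {ι : Type*} {Θi Ωi : ι → Type*} {ΘS : Set (∀ i, Θi i)}
    {φ : (∀ i, Θi i) → (∀ i, Ωi i)} {θ : ∀ i, Θi i} {ω : ∀ i, Ωi i} {G H : Finset ι}
    (hG : Detects ΘS φ θ ω G) (hGH : G ⊆ H) : Detects ΘS φ θ ω H := by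
  refine ⟨hG.1.mono hGH, fun θ' hθ' hag => ?_⟩
  obtain ⟨i, hi, hne⟩ := hG.2 θ' hθ' fun i hi => hag i (hGH hi)
  exact ⟨i, hGH hi, hne⟩

theorem detects_univ {ΘS : Set (Fin N → PrioReport N)} {θ : Fin N → PrioReport N}
    {ω : Fin N → Fin N} (hω : ω ≠ φ θ) : Detects ΘS φ θ ω Finset.univ := by
  obtain ⟨i, hi⟩ := Function.ne_iff.1 hω
  refine ⟨⟨i, Finset.mem_univ i⟩, fun θ' _ hag => ⟨i, Finset.mem_univ i, ?_⟩⟩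
  rwa [show θ' = θ from funext fun a => hag a (Finset.mem_univ a)]

theorem minDetect_le {ΘS : Set (Fin N → PrioReport N)} {θ : Fin N → PrioReport N}
    {ω : Fin N → Fin N} {G : Finset (Fin N)} (h : Detects ΘS φ θ ω G) :
    minDetect ΘS φ θ ω ≤ G.card :=
  Nat.sInf_le ⟨G, rfl, h⟩

theorem exists_detects_card_eq_minDetect {ΘS : Set (Fin N → PrioReport N)}
    {θ : Fin N → PrioReport N} {ω : Fin N → Fin N} (hω : ω ≠ φ θ) :
    ∃ G : Finset (Fin N), G.card = minDetect ΘS φ θ ω ∧ Detects ΘS φ θ ω G :=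
  Nat.sInf_mem (s := {n | ∃ G : Finset (Fin N), G.card = n ∧ Detects ΘS φ θ ω G})
    ⟨_, Finset.univ, rfl, detects_univ hω⟩

theorem minDetect_le_auditIndex {ΩS : Set (Fin N → Fin N)} {ΘS : Set (Fin N → PrioReport N)}
    {θ : Fin N → PrioReport N} {ω : Fin N → Fin N} (hω : ω ∈ ΩS) (hne : ω ≠ φ θ) :
    minDetect ΘS φ θ ω ≤ auditIndex ΩS ΘS φ θ := by
  refine le_csSup ⟨N, ?_⟩ ⟨ω, hω, hne, rfl⟩
  rintro n ⟨ω', -, hne', rfl⟩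
  simpa using minDetect_le (ΘS := ΘS) (detects_univ hne')

theorem auditIndex_le {ΩS : Set (Fin N → Fin N)} {ΘS : Set (Fin N → PrioReport N)}
    {θ : Fin N → PrioReport N} : auditIndex ΩS ΘS φ θ ≤ N := by
  refine csSup_le' ?_
  rintro n ⟨ω', -, hne', rfl⟩
  simpa using minDetect_le (ΘS := ΘS) (detects_univ hne')

theorem auditIndex_le_worstIndex {ΩS : Set (Fin N → Fin N)} {ΘS : Set (Fin N → PrioReport N)}
    {θ : Fin N → PrioReport N} (hθ : θ ∈ ΘS) :
    auditIndex ΩS ΘS φ θ ≤ worstIndex ΩS ΘS φ := by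
  refine le_csSup ⟨N, ?_⟩ ⟨θ, hθ, rfl⟩
  rintro n ⟨θ', -, rfl⟩
  exact auditIndex_le

theorem DARepresentable.two_le_minDetect (hφ : DARepresentable φ τ)
    {θ : Fin N → PrioReport N} (hθ : θ ∈ prioΘS N) {ω : Fin N → Fin N} (hω : Bijective ω)
    (hne : ω ≠ φ θ) : 2 ≤ minDetect (prioΘS N) φ θ ω := by
  obtain ⟨G, hcard, hG⟩ := exists_detects_card_eq_minDetect (ΘS := prioΘS N) hne
  rw [← hcard]
  by_contra hlt
  have h1 : G.card = 1 := by
    have := hG.1.card_pos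
    omega
  obtain ⟨i, rfl⟩ := Finset.card_eq_one.1 h1
  exact hφ.not_detects_singleton hθ hω i hG

theorem prioΘS_nonempty (N : ℕ) : (prioΘS N).Nonempty := by
  refine ⟨fun i => ((· < ·), fun _ => (i : ℕ)), fun _ => inferInstance, fun i j _ hij h => ?_⟩
  have h' : ((i : ℕ) : ℝ) = (j : ℕ) := h
  exact hij (Fin.ext (by exact_mod_cast h'))

theorem exists_bijective_ne (hN : 2 ≤ N) (μ : Fin N → Fin N) :
    ∃ ω : Fin N → Fin N, Bijective ω ∧ ω ≠ μ := by
  by_cases h : id = μ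
  · refine ⟨Equiv.swap (⟨0, by omega⟩ : Fin N) ⟨1, by omega⟩, Equiv.bijective _, fun he => ?_⟩
    have := congrFun (he.trans h.symm) ⟨0, by omega⟩
    simp at this
  · exact ⟨id, bijective_id, h⟩

end Index

/-- Theorem 2.2: let `φ` be DA-representable through `τ`. Then the
worst-case auditability index `#φ = 2` iff at every problem `θ = (P, r)` every
feasible deviation `ω ≠ φ θ` is either not stable at `(P, τ θ)`, or stable at
`(P, τ θ)` and there are two individuals `i, j` with (a) `ω(j) P_i ω(i)` and
`ω(i) P_j ω(j)`, and (b) every object `o ∉ {ω(i), ω(j)}` satisfies `o P_i ω(i)` or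
`o P_j ω(j)`. -/
theorem statement4 {N : ℕ} (hN : 2 ≤ N)
    (φ : (Fin N → PrioReport N) → (Fin N → Fin N))
    (τ : (Fin N → PrioReport N) → (Fin N → Fin N → ℝ))
    (hφ : DARepresentable φ τ) :
    worstIndex (allocΩS N) (prioΘS N) φ = 2 ↔
      ∀ θ ∈ prioΘS N, TwoDetectableCond (fun i => (θ i).1) (τ θ) (φ θ) := by

  have : NeZero N := ⟨by omega⟩
  constructor
  · intro hw θ hθ ω hω hne
    by_cases hst : StableAt (fun i => (θ i).1) (τ θ) ω
    · right
      obtain ⟨G, hcard, hG⟩ := exists_detects_card_eq_minDetect (ΘS := prioΘS N) hne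
      have hle : G.card ≤ 2 := by
        rw [hcard, ← hw]
        exact (minDetect_le_auditIndex hω hne).trans (auditIndex_le_worstIndex hθ)
      obtain ⟨H, hGH, hH⟩ := Finset.exists_superset_card_eq hle (by simpa using hN)
      obtain ⟨i, j, hij, rfl⟩ := Finset.card_eq_two.1 hH
      have hdet := hG.mono hGH
      obtain ⟨hpi, hpj⟩ := hφ.mutual_of_detects hθ hω hst hij hdet
      exact ⟨hst, i, j, hij, hpi, hpj, hφ.cover_of_detects hθ hω hst hij hdet⟩
    · exact Or.inl hst
  · intro hcond
    have hmin : ∀ θ ∈ prioΘS N, ∀ ω : Fin N → Fin N, Bijective ω → ω ≠ φ θ →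
        minDetect (prioΘS N) φ θ ω = 2 := by
      intro θ hθ ω hω hne
      refine le_antisymm ?_ (hφ.two_le_minDetect hθ hω hne)
      have hpair : ∃ i j, i ≠ j ∧ Detects (prioΘS N) φ θ ω {i, j} := by
        rcases hcond θ hθ ω hω hne with hst | ⟨-, i, j, hij, hpi, hpj, hcov⟩
        · exact hφ.exists_detects_of_not_stable hθ hst
        · exact ⟨i, j, hij, hφ.detects_of_cover hpi hpj hcov⟩
      obtain ⟨i, j, hij, hdet⟩ := hpair
      exact (minDetect_le hdet).trans_eq (Finset.card_pair hij)
    have haudit : ∀ θ ∈ prioΘS N, auditIndex (allocΩS N) (prioΘS N) φ θ = 2 := by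
      intro θ hθ
      obtain ⟨ω, hω, hne⟩ := exists_bijective_ne hN (φ θ)
      refine le_antisymm (csSup_le' ?_) ?_
      · rintro n ⟨ω', hω', hne', rfl⟩
        exact (hmin θ hθ ω' hω' hne').le
      · rw [← hmin θ hθ ω hω hne]
        exact minDetect_le_auditIndex hω hne
    obtain ⟨θ, hθ⟩ := prioΘS_nonempty N
    refine le_antisymm (csSup_le' ?_) ?_
    · rintro n ⟨θ', hθ', rfl⟩
      exact (haudit θ' hθ').le
    · rw [← haudit θ hθ]
      exact auditIndex_le_worstIndex hθ
end

section
/- For every integer e > 1, the worst-case auditability index of the application-rejection mechanism AR_e equals N, i.e., #AR_e = N; in particular, the worst-case auditability index of the Deferred Acceptance mechanism equals N (#DA = N). -/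
/-- The (0-indexed) tier of object `o` for preference `Pi` with permanency-execution
period `e`: `o` is a tier-`t` object iff `e * t ≤ |{o' : o' Pᵢ o}| < e * (t + 1)`. -/
noncomputable def tierOf {N : ℕ} (e : ℕ) (Pi : Fin N → Fin N → Prop) (o : Fin N) : ℕ :=
  Set.ncard {o' | Pi o' o} / e

/-- `φ` is the application-rejection mechanism `AR_e`: at every problem `θ = (P, r)`,
`φ θ = DA(P, r̂)` where the modified priority scores `r̂` satisfy
`r̂ᵢₒ > r̂ⱼₒ` iff `i` ranks `o` in a strictly better tier than `j`, or they rank `o` in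
the same tier and `rᵢₒ > rⱼₒ`. -/
def IsARMechanism {N : ℕ} (e : ℕ)
    (φ : (Fin N → PrioReport N) → (Fin N → Fin N)) : Prop :=
  ∀ θ ∈ prioΘS N, ∃ rhat : Fin N → Fin N → ℝ,
    (∀ i j o, i ≠ j →
      (rhat i o > rhat j o ↔
        tierOf e (θ i).1 o < tierOf e (θ j).1 o ∨
          (tierOf e (θ i).1 o = tierOf e (θ j).1 o ∧ (θ i).2 o > (θ j).2 o))) ∧
    IsDAOutcome (fun i => (θ i).1) rhat (φ θ)

/-- Detection is monotone in the group, so a deviation that no group of the form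
`{k}ᶜ` detects can only be detected by everyone. -/
theorem card_le_of_detects {ι : Type*} [Fintype ι] [DecidableEq ι]
    {Θi Ωi : ι → Type*} {ΘS : Set (∀ i, Θi i)} {φ : (∀ i, Θi i) → (∀ i, Ωi i)}
    {θ : ∀ i, Θi i} {ω : ∀ i, Ωi i}
    (h : ∀ k, ∃ θ' ∈ ΘS, (∀ i, i ≠ k → θ' i = θ i) ∧ φ θ' = ω)
    {G : Finset ι} (hG : Detects ΘS φ θ ω G) : Fintype.card ι ≤ G.card := by
  suffices G = Finset.univ by rw [this, Finset.card_univ]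
  refine Finset.eq_univ_iff_forall.2 fun k => ?_
  by_contra hk
  obtain ⟨θ', hθ', hagree, hφ⟩ := h k
  obtain ⟨i, -, hi⟩ := hG.2 θ' hθ' fun i hi => hagree i fun hik => hk (hik ▸ hi)
  exact hi (congrFun hφ i).symm

theorem detects_univ_s7 {ι : Type*} [Fintype ι] [DecidableEq ι] [Nonempty ι]
    {Θi Ωi : ι → Type*} {ΘS : Set (∀ i, Θi i)} {φ : (∀ i, Θi i) → (∀ i, Ωi i)}
    {θ : ∀ i, Θi i} {ω : ∀ i, Ωi i} (hω : ω ≠ φ θ) :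
    Detects ΘS φ θ ω Finset.univ := by
  refine ⟨Finset.univ_nonempty, fun θ' _ hagree => ?_⟩
  obtain rfl : θ' = θ := funext fun i => hagree i (Finset.mem_univ i)
  simpa using Function.ne_iff.1 hω

theorem minDetect_le_card {ι : Type*} [Fintype ι] [DecidableEq ι] [Nonempty ι]
    {Θi Ωi : ι → Type*} {ΘS : Set (∀ i, Θi i)} {φ : (∀ i, Θi i) → (∀ i, Ωi i)}
    {θ : ∀ i, Θi i} {ω : ∀ i, Ωi i} (hω : ω ≠ φ θ) :
    minDetect ΘS φ θ ω ≤ Fintype.card ι :=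
  Nat.sInf_le ⟨Finset.univ, Finset.card_univ, detects_univ_s7 hω⟩

theorem auditIndex_le_card {ι : Type*} [Fintype ι] [DecidableEq ι] [Nonempty ι]
    {Θi Ωi : ι → Type*} (ΩS : Set (∀ i, Ωi i)) (ΘS : Set (∀ i, Θi i))
    (φ : (∀ i, Θi i) → (∀ i, Ωi i)) (θ : ∀ i, Θi i) :
    auditIndex ΩS ΘS φ θ ≤ Fintype.card ι := by
  refine csSup_le' ?_
  rintro n ⟨ω, -, hω, rfl⟩
  exact minDetect_le_card hω

/-- The worst-case index is the number of individuals as soon as some deviation can be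
explained by changing the report of any single individual. -/
theorem worstIndex_eq_card {ι : Type*} [Fintype ι] [DecidableEq ι] [Nonempty ι]
    {Θi Ωi : ι → Type*} {ΩS : Set (∀ i, Ωi i)} {ΘS : Set (∀ i, Θi i)}
    {φ : (∀ i, Θi i) → (∀ i, Ωi i)} {θ : ∀ i, Θi i} {ω : ∀ i, Ωi i}
    (hθ : θ ∈ ΘS) (hωS : ω ∈ ΩS) (hω : ω ≠ φ θ)
    (h : ∀ k, ∃ θ' ∈ ΘS, (∀ i, i ≠ k → θ' i = θ i) ∧ φ θ' = ω) :
    worstIndex ΩS ΘS φ = Fintype.card ι := by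
  have hmin : minDetect ΘS φ θ ω = Fintype.card ι := by
    refine le_antisymm (minDetect_le_card hω) (le_csInf ?_ ?_)
    · exact ⟨_, Finset.univ, Finset.card_univ, detects_univ_s7 hω⟩
    · rintro n ⟨G, rfl, hG⟩
      exact card_le_of_detects h hG
  have haudit : auditIndex ΩS ΘS φ θ = Fintype.card ι := by
    refine le_antisymm (auditIndex_le_card ΩS ΘS φ θ) (le_csSup ?_ ⟨ω, hωS, hω, hmin⟩)
    refine ⟨Fintype.card ι, ?_⟩
    rintro n ⟨ω', -, hω', rfl⟩
    exact minDetect_le_card hω'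
  refine le_antisymm (csSup_le' ?_) (le_csSup ⟨Fintype.card ι, ?_⟩ ⟨θ, hθ, haudit⟩)
  all_goals
    rintro n ⟨θ', -, rfl⟩
    exact auditIndex_le_card ΩS ΘS φ θ'

section TopTwo

variable {N : ℕ}

/-- The position of `o` when `a` is ranked first, `b` second, and all other objects
below them in their natural order. -/
def topTwoRank (a b o : Fin N) : ℕ :=
  if o = a then 0 else if o = b then 1 else o + 2

/-- The preference that ranks `a` first and `b` second. -/
def topTwoPref (a b o o' : Fin N) : Prop :=
  topTwoRank a b o < topTwoRank a b o'

theorem topTwoRank_injective (a b : Fin N) : Function.Injective (topTwoRank a b) := by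
  intro o o' h
  unfold topTwoRank at h
  split_ifs at h <;> omega

theorem isStrictTotalOrder_topTwoPref (a b : Fin N) :
    IsStrictTotalOrder (Fin N) (topTwoPref a b) :=
  (RelEmbedding.preimage ⟨_, topTwoRank_injective a b⟩ (· < ·)).isStrictTotalOrder

theorem not_topTwoPref_first (a b o : Fin N) : ¬ topTwoPref a b o a := by
  simp [topTwoPref, topTwoRank]

theorem eq_of_topTwoPref_second {a b o : Fin N} (h : topTwoPref a b o b) : o = a := by
  unfold topTwoPref topTwoRank at h
  split_ifs at h <;> first | assumption | omega

theorem tierOf_topTwoPref_first (e : ℕ) (a b : Fin N) :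
    tierOf e (topTwoPref a b) a = 0 := by
  simp [tierOf, not_topTwoPref_first]

theorem tierOf_topTwoPref_second {e : ℕ} (he : 1 < e) (a b : Fin N) :
    tierOf e (topTwoPref a b) b = 0 := by
  refine Nat.div_eq_of_lt (lt_of_le_of_lt ?_ he)
  calc Set.ncard {o | topTwoPref a b o b} ≤ Set.ncard {a} :=
        Set.ncard_le_ncard (fun o ho => eq_of_topTwoPref_second ho)
    _ = 1 := Set.ncard_singleton a

end TopTwo

section CyclicProblem

variable {N : ℕ} (s : Equiv.Perm (Fin N))

/-- The scores that give `i` top priority at `s i`. -/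
def shiftScore (i o : Fin N) : ℝ := if o = s i then N else (i : ℕ)

/-- Everybody likes her own object best and the object `s i` second best. -/
def cyclicProblem (i : Fin N) : PrioReport N := (topTwoPref i (s i), shiftScore s i)

/-- The cyclic problem in which `k` swaps her two favourite objects. -/
def perturbedProblem (k i : Fin N) : PrioReport N :=
  (if i = k then topTwoPref (s i) i else topTwoPref i (s i), shiftScore s i)

theorem shiftScore_le (i o : Fin N) : shiftScore s i o ≤ N := by
  unfold shiftScore
  split_ifs
  · exact le_rfl
  · exact_mod_cast i.isLt.le

theorem shiftScore_ne {i j : Fin N} (hij : i ≠ j) (o : Fin N) :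
    shiftScore s i o ≠ shiftScore s j o := by
  unfold shiftScore
  have hi := i.isLt
  have hj := j.isLt
  split_ifs with h₁ h₂
  · exact absurd (s.injective (h₁.symm.trans h₂)) hij
  all_goals norm_cast; omega

theorem cyclicProblem_mem : cyclicProblem s ∈ prioΘS N :=
  ⟨fun _ => isStrictTotalOrder_topTwoPref _ _, fun _ _ o hij => shiftScore_ne s hij o⟩

theorem perturbedProblem_mem (k : Fin N) : perturbedProblem s k ∈ prioΘS N := by
  refine ⟨fun i => ?_, fun _ _ o hij => shiftScore_ne s hij o⟩
  unfold perturbedProblem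
  split_ifs <;> exact isStrictTotalOrder_topTwoPref _ _

theorem perturbedProblem_of_ne {k i : Fin N} (h : i ≠ k) :
    perturbedProblem s k i = cyclicProblem s i := by
  simp [perturbedProblem, cyclicProblem, h]

theorem perturbedProblem_self (k : Fin N) :
    (perturbedProblem s k k).1 = topTwoPref (s k) k := by
  simp [perturbedProblem]

theorem tierOf_perturbedProblem {e : ℕ} (he : 1 < e) (k i : Fin N) :
    tierOf e (perturbedProblem s k i).1 (s i) = 0 := by
  unfold perturbedProblem
  split_ifs
  · exact tierOf_topTwoPref_first e _ _
  · exact tierOf_topTwoPref_second he _ _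

variable {s}

theorem IsDAOutcome.eq_id_of_cyclicProblem {r : Fin N → Fin N → ℝ} {ω : Fin N → Fin N}
    (h : IsDAOutcome (fun i => (cyclicProblem s i).1) r ω) : ω = id := by
  funext i
  refine (h.2.2 id Function.bijective_id ?_ i).resolve_right (not_topTwoPref_first _ _ _)
  rintro ⟨i, j, o, ho, -⟩
  exact not_topTwoPref_first _ _ _ ho

/-- Following the cycle from `k`, each individual takes the next one's favourite object. -/
theorem IsARMechanism.perturbedProblem_eq {e : ℕ} (he : 1 < e)
    {φ : (Fin N → PrioReport N) → (Fin N → Fin N)} (hφ : IsARMechanism e φ)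
    (hs : s.IsCycle) (hne : ∀ i, s i ≠ i) (k : Fin N) :
    φ (perturbedProblem s k) = s := by
  obtain ⟨rhat, hr, hbij, -, hopt⟩ := hφ _ (perturbedProblem_mem s k)
  have hstable : StableAt (fun i => (perturbedProblem s k i).1) rhat s := by
    rintro ⟨i, j, o, ho, rfl, hgt⟩
    have hij : i ≠ j := by
      rintro rfl
      exact lt_irrefl _ hgt
    rcases (hr i j _ hij).1 hgt with h | h
    · rw [tierOf_perturbedProblem s he] at h
      exact Nat.not_lt_zero _ h
    · have hj : shiftScore s j (s j) = N := by simp [shiftScore]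
      have hlt : shiftScore s j (s j) < shiftScore s i (s j) := h.2
      exact absurd (shiftScore_le s i (s j)) (not_le.2 (hj ▸ hlt))
  have hweak := hopt s s.bijective hstable
  have hk : φ (perturbedProblem s k) k = s k := by
    refine (hweak k).resolve_right fun h => ?_
    simp only [perturbedProblem_self] at h
    exact not_topTwoPref_first _ _ _ h
  have hstep (i : Fin N) (hi : φ (perturbedProblem s k) i = s i) :
      φ (perturbedProblem s k) (s i) = s (s i) := by
    by_cases hik : s i = k
    · rw [hik, hk]
    · refine (hweak (s i)).resolve_right fun h => ?_
      simp only [perturbedProblem_of_ne s hik] at h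
      exact hne i (hbij.1 ((eq_of_topTwoPref_second h).trans hi.symm))
  have hpow (n : ℕ) : φ (perturbedProblem s k) ((s ^ n) k) = s ((s ^ n) k) := by
    induction n with
    | zero => exact hk
    | succ n ih =>
      rw [pow_succ', Equiv.Perm.mul_apply]
      exact hstep _ ih
  funext i
  obtain ⟨n, rfl⟩ := hs.exists_pow_eq (hne k) (hne i)
  exact hpow n

end CyclicProblem

theorem IsARMechanism.worstIndex_eq {N e : ℕ} (hN : 2 ≤ N) (he : 1 < e)
    {φ : (Fin N → PrioReport N) → (Fin N → Fin N)} (hφ : IsARMechanism e φ) :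
    worstIndex (allocΩS N) (prioΘS N) φ = N := by
  obtain ⟨n, rfl⟩ := Nat.exists_eq_add_of_le' hN
  have hs : (finRotate (n + 2)).IsCycle := isCycle_finRotate
  have hne (i : Fin (n + 2)) : finRotate (n + 2) i ≠ i := by
    rw [← Equiv.Perm.mem_support, support_finRotate]
    exact Finset.mem_univ i
  obtain ⟨r, -, hDA⟩ := hφ _ (cyclicProblem_mem (finRotate (n + 2)))
  refine (worstIndex_eq_card (ω := finRotate (n + 2)) (cyclicProblem_mem (finRotate (n + 2)))
    (finRotate (n + 2)).bijective ?_ fun k => ?_).trans (Fintype.card_fin _)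
  · rw [hDA.eq_id_of_cyclicProblem]
    exact fun h => hne 0 (congrFun h 0)
  · exact ⟨perturbedProblem _ k, perturbedProblem_mem _ k,
      fun i hi => perturbedProblem_of_ne _ hi, hφ.perturbedProblem_eq he hs hne k⟩

theorem tierOf_eq_zero {N : ℕ} {Pi : Fin N → Fin N → Prop} [Std.Irrefl Pi] (o : Fin N) :
    tierOf N Pi o = 0 := by
  refine Nat.div_eq_of_lt ?_
  calc Set.ncard {o' | Pi o' o} < Set.ncard (Set.univ : Set (Fin N)) :=
        Set.ncard_lt_ncard (Set.ssubset_univ_iff.2 fun h =>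
          irrefl_of Pi o (h.symm ▸ Set.mem_univ o : o ∈ {o' | Pi o' o}))
    _ = N := by simp [Set.ncard_univ]

/-- Deferred Acceptance is the application-rejection mechanism with a single tier. -/
theorem isARMechanism_of_isDAOutcome {N : ℕ}
    {φ : (Fin N → PrioReport N) → (Fin N → Fin N)}
    (h : ∀ θ ∈ prioΘS N, IsDAOutcome (fun i => (θ i).1) (fun i => (θ i).2) (φ θ)) :
    IsARMechanism N φ := by
  refine fun θ hθ => ⟨fun i => (θ i).2, fun i j o _ => ?_, h θ hθ⟩
  have := hθ.1 i
  have := hθ.1 j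
  simp [tierOf_eq_zero]

/-- Proposition 4: for every `e > 1` the worst-case auditability index
of `AR_e` equals `N`; in particular the worst-case auditability index of the Deferred
Acceptance mechanism equals `N`. -/
theorem statement7 {N : ℕ} (hN : 2 ≤ N) :
    (∀ e : ℕ, 1 < e →
      ∀ φ : (Fin N → PrioReport N) → (Fin N → Fin N), IsARMechanism e φ →
        worstIndex (allocΩS N) (prioΘS N) φ = N) ∧
    (∀ φ : (Fin N → PrioReport N) → (Fin N → Fin N),
      (∀ θ ∈ prioΘS N, IsDAOutcome (fun i => (θ i).1) (fun i => (θ i).2) (φ θ)) →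
        worstIndex (allocΩS N) (prioΘS N) φ = N) := by
  exact ⟨fun _ he _ hφ => hφ.worstIndex_eq hN he,
    fun _ hφ => (isARMechanism_of_isDAOutcome hφ).worstIndex_eq hN (by omega)⟩
end
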